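/- arXiv:2504.18909 — 2 statements merged into one kernel-verified Lean document; each statement's English description precedes it below -/
import Mathlib

section
/- The canonical projection from the ring ℤ₂ of 2-adic integers onto ℤ/8 induces a ring isomorphism GW(ℤ₂) ≅ GW(ℤ/8); consequently there is an isomorphism of abelian groups ℤ × ℤ/4 × ℤ/2 ≅ GW(ℤ₂) sending (1, 0, 0) to [1], (0, 1, 0) to ⟨⟨3⟩⟩ = [1] − [3], and (0, 0, 1) to ⟨⟨5⟩⟩ = [1] − [5]. -/
noncomputable section

/-- The subgroup of squares of units of a commutative ring. -/
def squareUnits (R : Type) [CommRing R] : Subgroup Rˣ :=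
  (powMonoidHom 2 : Rˣ →* Rˣ).range

/-- The group of square classes `Rˣ/(Rˣ)²`. -/
def SqCl (R : Type) [CommRing R] : Type := Rˣ ⧸ squareUnits R

instance (R : Type) [CommRing R] : CommGroup (SqCl R) :=
  QuotientGroup.Quotient.commGroup (squareUnits R)

/-- The square class `[a]` of a unit `a`. -/
def cls {R : Type} [CommRing R] (a : Rˣ) : SqCl R := QuotientGroup.mk a

/-- The group ring `ℤ[Rˣ/(Rˣ)²]`. -/
abbrev GRing (R : Type) [CommRing R] := MonoidAlgebra ℤ (SqCl R)

/-- The generator `[a]` of the group ring, for a unit `a`. -/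
def gen {R : Type} [CommRing R] (a : Rˣ) : GRing R :=
  MonoidAlgebra.of ℤ (SqCl R) (cls a)

/-- The set of relations defining the Grothendieck–Witt ring of a (connected semi-)local ring:
`([a₁]+[a₂]+[a₃]+[a₄]) − ([b₁]+[b₂]+[b₃]+[b₄])` whenever there exists `P ∈ GL₄(R)` with
`P ⬝ diag(a₁,…,a₄) ⬝ Pᵀ = diag(b₁,…,b₄)`. -/
def gwRel (R : Type) [CommRing R] : Set (GRing R) :=
  {x | ∃ (a b : Fin 4 → Rˣ) (P : Matrix (Fin 4) (Fin 4) R),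
    IsUnit P.det ∧
    P * Matrix.diagonal (fun i => (a i : R)) * P.transpose =
      Matrix.diagonal (fun i => (b i : R)) ∧
    x = (∑ i, gen (a i)) - (∑ i, gen (b i))}

/-- The (symmetric) Grothendieck–Witt ring of `R`, presented à la Knebusch–Rosenberg–Ware. -/
abbrev GW (R : Type) [CommRing R] := GRing R ⧸ Ideal.span (gwRel R)

/-- The class `[a] ∈ GW(R)` of a unit `a`. -/
def gw {R : Type} [CommRing R] (a : Rˣ) : GW R :=
  Ideal.Quotient.mk (Ideal.span (gwRel R)) (gen a)

/-- The (symmetric) Witt ring of `R` : the quotient of `GW(R)` by the ideal generated by the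
hyperbolic element `[1] + [-1]`. -/
abbrev Wr (R : Type) [CommRing R] := GW R ⧸ Ideal.span {gw (R := R) 1 + gw (-1)}

/-- The class in the Witt ring of a unit `a`. -/
def wcl {R : Type} [CommRing R] (a : Rˣ) : Wr R :=
  Ideal.Quotient.mk (Ideal.span {gw (R := R) 1 + gw (-1)}) (gw a)


namespace GWAux

theorem cls_mul {R : Type} [CommRing R] (a b : Rˣ) : cls (a * b) = cls a * cls b := rfl

theorem gen_mul {R : Type} [CommRing R] (a b : Rˣ) : gen (a * b) = gen a * gen b := by
  unfold gen
  rw [cls_mul, map_mul]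

theorem gen_one {R : Type} [CommRing R] : gen (1 : Rˣ) = 1 :=
  map_one (MonoidAlgebra.of ℤ (SqCl R))

theorem gw_one {R : Type} [CommRing R] : gw (1 : Rˣ) = 1 := by
  unfold gw
  rw [gen_one, map_one]

theorem gw_mul {R : Type} [CommRing R] (a b : Rˣ) : gw (a * b) = gw a * gw b := by
  unfold gw
  rw [gen_mul, map_mul]

theorem cls_sq {R : Type} [CommRing R] (u : Rˣ) : cls (u ^ 2) = 1 :=
  (QuotientGroup.eq_one_iff (N := squareUnits R) _).2 ⟨u, rfl⟩

theorem gw_sq {R : Type} [CommRing R] (a u : Rˣ) : gw (a * u ^ 2) = gw a := by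
  unfold gw gen
  rw [cls_mul, cls_sq, mul_one]

theorem gw_rel {R : Type} [CommRing R] (a b : Fin 4 → Rˣ) (P : Matrix (Fin 4) (Fin 4) R)
    (hP : IsUnit P.det)
    (h : P * Matrix.diagonal (fun i => (a i : R)) * P.transpose =
      Matrix.diagonal (fun i => (b i : R))) :
    ∑ i, gw (a i) = ∑ i, gw (b i) := by
  have : Ideal.Quotient.mk (Ideal.span (gwRel R)) ((∑ i, gen (a i)) - (∑ i, gen (b i))) = 0 :=
    Ideal.Quotient.eq_zero_iff_mem.2 (Ideal.subset_span ⟨a, b, P, hP, h, rfl⟩)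
  rw [map_sub, map_sum, map_sum, sub_eq_zero] at this
  exact this

/-- Induction principle for the group ring. -/
theorem gring_ind {R : Type} [CommRing R] {p : GRing R → Prop} (x : GRing R)
    (hg : ∀ a : Rˣ, p (gen a)) (ha : ∀ x y, p x → p y → p (x + y))
    (hz : ∀ (n : ℤ) x, p x → p (n • x)) : p x := by
  refine MonoidAlgebra.induction_on x ?_ ha hz
  intro g
  obtain ⟨a, rfl⟩ := QuotientGroup.mk_surjective g
  exact hg a

theorem gw_span {R : Type} [CommRing R] (S : AddSubgroup (GW R)) (h : ∀ a : Rˣ, gw a ∈ S)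
    (x : GW R) : x ∈ S := by
  obtain ⟨y, rfl⟩ := Ideal.Quotient.mk_surjective x
  refine gring_ind (p := fun y => Ideal.Quotient.mk (Ideal.span (gwRel R)) y ∈ S) y h ?_ ?_
  · intro x y hx hy
    rw [map_add]
    exact S.add_mem hx hy
  · intro n x hx
    rw [map_zsmul]
    exact S.zsmul_mem hx n

/-! ### Functoriality -/

/-- The map on square classes to `GW S` induced by a ring homomorphism. -/
def mapCls {R S : Type} [CommRing R] [CommRing S] (φ : R →+* S) : SqCl R →* GW S :=
  QuotientGroup.lift (squareUnits R)
    { toFun := fun a => gw (Units.map (φ : R →* S) a)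
      map_one' := by rw [map_one, gw_one]
      map_mul' := fun a b => by rw [map_mul, gw_mul] }
    (by
      rintro _ ⟨u, rfl⟩
      have := gw_sq 1 (Units.map (φ : R →* S) u)
      rw [one_mul, gw_one, ← map_pow] at this
      exact this)

/-- The map on group rings. -/
def mapG {R S : Type} [CommRing R] [CommRing S] (φ : R →+* S) : GRing R →+* GW S :=
  (MonoidAlgebra.lift ℤ (GW S) (SqCl R) (mapCls φ)).toRingHom

theorem mapG_gen {R S : Type} [CommRing R] [CommRing S] (φ : R →+* S) (a : Rˣ) :
    mapG φ (gen a) = gw (Units.map (φ : R →* S) a) :=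
  MonoidAlgebra.lift_of (mapCls φ) (cls a)

theorem mapG_rel {R S : Type} [CommRing R] [CommRing S] (φ : R →+* S) (x : GRing R)
    (hx : x ∈ Ideal.span (gwRel R)) : mapG φ x = 0 := by
  suffices h : Ideal.span (gwRel R) ≤ RingHom.ker (mapG φ) from h hx
  rw [Ideal.span_le]
  rintro _ ⟨a, b, P, hP, h, rfl⟩
  rw [SetLike.mem_coe, RingHom.mem_ker, map_sub, map_sum, map_sum, sub_eq_zero]
  simp only [mapG_gen]
  refine gw_rel _ _ (φ.mapMatrix P) ?_ ?_
  · rw [← RingHom.map_det]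
    exact hP.map φ
  · have := congrArg φ.mapMatrix h
    simpa [Matrix.diagonal_map, Matrix.transpose_map, Function.comp_def] using this

/-- The induced map on Grothendieck–Witt rings. -/
def mapGW {R S : Type} [CommRing R] [CommRing S] (φ : R →+* S) : GW R →+* GW S :=
  Ideal.Quotient.lift _ (mapG φ) (mapG_rel φ)

theorem mapGW_gw {R S : Type} [CommRing R] [CommRing S] (φ : R →+* S) (a : Rˣ) :
    mapGW φ (gw a) = gw (Units.map (φ : R →* S) a) :=
  mapG_gen φ a

/-! ### The invariant over `ℤ/8` -/

abbrev T := ℤ × ZMod 4 × ZMod 2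

/-- The values of the invariant on units modulo `8`. -/
def F0 (x : ZMod (2 ^ 3)) : T :=
  (1, if x = 3 ∨ x = 7 then -1 else 0, if x = 5 ∨ x = 7 then 1 else 0)

theorem sq8 : ∀ u : (ZMod (2 ^ 3))ˣ, u ^ 2 = 1 := by decide

def F1 : SqCl (ZMod (2 ^ 3)) → T :=
  Quotient.lift (fun u : (ZMod (2 ^ 3))ˣ => F0 u) (by
    intro a b h
    obtain ⟨u, hu⟩ := QuotientGroup.leftRel_apply.1 h
    have h1 : a⁻¹ * b = 1 := by rw [← hu]; exact sq8 u
    rw [inv_mul_eq_one.1 h1])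

def F2 : GRing (ZMod (2 ^ 3)) →+ T :=
  MonoidAlgebra.liftNC (Int.castAddHom T) F1

theorem F2_gen (a : (ZMod (2 ^ 3))ˣ) : F2 (gen a) = F0 a := by
  have : F2 (gen a) = (Int.castAddHom T) 1 * F1 (cls a) := MonoidAlgebra.liftNC_single _ _ _ _
  rw [this]
  simp
  rfl

theorem trace_inv (a b : Fin 4 → (ZMod (2 ^ 3))ˣ) (P : Matrix (Fin 4) (Fin 4) (ZMod (2 ^ 3)))
    (h : P * Matrix.diagonal (fun i => (a i : ZMod (2 ^ 3))) * P.transpose =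
      Matrix.diagonal (fun i => (b i : ZMod (2 ^ 3)))) :
    ∑ i, (a i : ZMod (2 ^ 3)) = ∑ i, (b i : ZMod (2 ^ 3)) := by
  let φ : ZMod (2 ^ 3) →+* ZMod 2 := ZMod.castHom (by norm_num) (ZMod 2)
  have hu : ∀ u : (ZMod (2 ^ 3))ˣ, φ u = 1 := by decide
  have hs : ∀ x : ZMod 2, x * x = x := by decide
  have h8 : ∀ x : ZMod (2 ^ 3), φ x = 1 → x * x = 1 := by decide
  have hQ : φ.mapMatrix P * (φ.mapMatrix P).transpose = 1 := by
    have := congrArg φ.mapMatrix h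
    simpa [Matrix.diagonal_map, Matrix.transpose_map, Function.comp_def, hu] using this
  have hQ' := mul_eq_one_comm.1 hQ
  have hc : ∀ i, (∑ j, P j i) * (∑ j, P j i) = 1 := by
    intro i
    apply h8
    have := congrFun (congrFun hQ' i) i
    simpa [Matrix.mul_apply, hs] using this
  have hb : ∀ j k, ∑ i, P j i * a i * P k i = if j = k then (b j : ZMod (2 ^ 3)) else 0 := by
    intro j k
    have := congrFun (congrFun h j) k
    rw [Matrix.mul_apply] at this
    simpa [Matrix.mul_diagonal, Matrix.diagonal_apply] using this
  calc ∑ i, (a i : ZMod (2 ^ 3))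
      = ∑ i, ((∑ j, P j i) * (∑ j, P j i)) * a i := by simp [hc]
    _ = ∑ j, ∑ k, ∑ i, P j i * a i * P k i := by
        simp only [Fin.sum_univ_four]
        ring
    _ = ∑ i, (b i : ZMod (2 ^ 3)) := by simp [hb]

theorem det_inv (a b : Fin 4 → (ZMod (2 ^ 3))ˣ) (P : Matrix (Fin 4) (Fin 4) (ZMod (2 ^ 3)))
    (hP : IsUnit P.det)
    (h : P * Matrix.diagonal (fun i => (a i : ZMod (2 ^ 3))) * P.transpose =
      Matrix.diagonal (fun i => (b i : ZMod (2 ^ 3)))) :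
    ∏ i, (a i : ZMod (2 ^ 3)) = ∏ i, (b i : ZMod (2 ^ 3)) := by
  have := congrArg Matrix.det h
  rw [Matrix.det_mul, Matrix.det_mul, Matrix.det_transpose, Matrix.det_diagonal,
    Matrix.det_diagonal] at this
  obtain ⟨u, hu⟩ := hP
  have h1 : P.det * P.det = 1 := by
    rw [← hu, ← Units.val_mul, ← sq, sq8, Units.val_one]
  rw [← this, mul_right_comm, h1, one_mul]

/-- The invariant recovered from trace and determinant. -/
def G0 (s p : ZMod (2 ^ 3)) : T :=
  (4, -(((s - 4 - (if p = 5 ∨ p = 7 then 4 else 0)).val / 2 : ℕ) : ZMod 4),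
    if p = 5 ∨ p = 7 then 1 else 0)

theorem F0_G0 : ∀ a b c d : (ZMod (2 ^ 3))ˣ,
    F0 a + F0 b + F0 c + F0 d =
      G0 ((a : ZMod (2 ^ 3)) + (b : ZMod (2 ^ 3)) + (c : ZMod (2 ^ 3)) + (d : ZMod (2 ^ 3)))
        ((a : ZMod (2 ^ 3)) * (b : ZMod (2 ^ 3)) * (c : ZMod (2 ^ 3)) * (d : ZMod (2 ^ 3))) := by
  have key : ∀ a ∈ ([1, 3, 5, 7] : List (ZMod (2 ^ 3))), ∀ b ∈ ([1, 3, 5, 7] : List (ZMod (2 ^ 3))),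
      ∀ c ∈ ([1, 3, 5, 7] : List (ZMod (2 ^ 3))), ∀ d ∈ ([1, 3, 5, 7] : List (ZMod (2 ^ 3))),
      F0 a + F0 b + F0 c + F0 d = G0 (a + b + c + d) (a * b * c * d) := by
    decide +kernel
  have hm : ∀ u : (ZMod (2 ^ 3))ˣ, (u : ZMod (2 ^ 3)) ∈ ([1, 3, 5, 7] : List (ZMod (2 ^ 3))) := by
    decide
  exact fun a b c d => key _ (hm a) _ (hm b) _ (hm c) _ (hm d)

theorem F2_rel (a b : Fin 4 → (ZMod (2 ^ 3))ˣ) (P : Matrix (Fin 4) (Fin 4) (ZMod (2 ^ 3)))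
    (hP : IsUnit P.det)
    (h : P * Matrix.diagonal (fun i => (a i : ZMod (2 ^ 3))) * P.transpose =
      Matrix.diagonal (fun i => (b i : ZMod (2 ^ 3)))) :
    F2 ((∑ i, gen (a i)) - (∑ i, gen (b i))) = 0 := by
  have h1 := trace_inv a b P h
  have h2 := det_inv a b P hP h
  rw [map_sub, map_sum, map_sum, sub_eq_zero]
  simp only [F2_gen]
  rw [Fin.sum_univ_four] at h1 ⊢
  rw [Fin.sum_univ_four] at h1 ⊢
  rw [Fin.prod_univ_four, Fin.prod_univ_four] at h2
  rw [F0_G0, F0_G0, h1, h2]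

theorem F2_ideal (x : GRing (ZMod (2 ^ 3))) (hx : x ∈ Ideal.span (gwRel (ZMod (2 ^ 3)))) :
    F2 x = 0 := by
  suffices H : ∀ y, F2 (y * x) = 0 by simpa using H 1
  refine Submodule.span_induction (p := fun x _ => ∀ y, F2 (y * x) = 0) ?_ ?_ ?_ ?_ hx
  · rintro _ ⟨a, b, P, hP, h, rfl⟩ y
    refine gring_ind (p := fun y => F2 (y * _) = 0) y ?_ ?_ ?_
    · intro u
      rw [mul_sub, Finset.mul_sum, Finset.mul_sum]
      simp only [← gen_mul]
      refine F2_rel (fun i => u * a i) (fun i => u * b i) P hP ?_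
      have e1 : ∀ c : Fin 4 → (ZMod (2 ^ 3))ˣ,
          Matrix.diagonal (fun i => ((u * c i : (ZMod (2 ^ 3))ˣ) : ZMod (2 ^ 3))) =
          (u : ZMod (2 ^ 3)) • Matrix.diagonal (fun i => (c i : ZMod (2 ^ 3))) := by
        intro c
        rw [← Matrix.diagonal_smul]
        rfl
      rw [e1, e1, Matrix.mul_smul, Matrix.smul_mul, h]
    · intro x y hx hy
      rw [add_mul, map_add, hx, hy, add_zero]
    · intro n x hx
      rw [smul_mul_assoc, map_zsmul, hx, smul_zero]
  · intro y
    simp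
  · intro x y _ _ hx hy z
    rw [mul_add, map_add, hx, hy, add_zero]
  · intro c x _ hx y
    rw [smul_eq_mul, ← mul_assoc]
    exact hx _

/-- The invariant on `GW(ℤ/8)`. -/
def inv8 : GW (ZMod (2 ^ 3)) →+ T :=
  QuotientAddGroup.lift (Submodule.toAddSubgroup (Ideal.span (gwRel (ZMod (2 ^ 3))))) F2 F2_ideal

theorem inv8_gw (a : (ZMod (2 ^ 3))ˣ) : inv8 (gw a) = F0 a := F2_gen a

/-! ### Computations in `GW(ℤ₂)` -/

/-- Reduction modulo `8`. -/
abbrev red : ℤ_[2] →+* ZMod (2 ^ 3) := PadicInt.toZModPow 3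

theorem exists_sqrt (u : ℤ_[2]) (hu : red u = 1) : ∃ z : ℤ_[2], z ^ 2 = u := by
  have h1 : (1 - u) ∈ RingHom.ker red := by
    rw [RingHom.mem_ker, map_sub, map_one, hu, sub_self]
  rw [PadicInt.ker_toZModPow, ← PadicInt.norm_le_pow_iff_mem_span_pow] at h1
  have h2 : ‖(2 : ℤ_[2])‖ = 2⁻¹ := by
    have := PadicInt.norm_p (p := 2)
    simpa using this
  obtain ⟨z, hz, -⟩ := hensels_lemma (p := 2) (R := ℤ_[2])
    (F := Polynomial.X ^ 2 - Polynomial.C u) (a := 1) (by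
      simp only [Polynomial.derivative_sub, Polynomial.derivative_X_pow, Polynomial.derivative_C,
        map_sub, map_pow, Polynomial.aeval_X, Polynomial.aeval_C, map_mul, map_natCast]
      simp only [Nat.cast_ofNat, one_pow, sub_zero, mul_one, Algebra.algebraMap_self,
        RingHom.id_apply, h2]
      refine lt_of_le_of_lt h1 ?_
      norm_num [h2])
  refine ⟨z, ?_⟩
  simpa [sub_eq_zero] using hz

theorem gw_eq_of_red (a b : ℤ_[2]ˣ) (h : red a = red b) : gw a = gw b := by
  have h1 : red ((b⁻¹ * a : ℤ_[2]ˣ) : ℤ_[2]) = 1 := by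
    rw [Units.val_mul, map_mul, h, ← map_mul, Units.inv_mul, map_one]
  obtain ⟨z, hz⟩ := exists_sqrt _ h1
  have hzu : IsUnit z := by
    rw [← isUnit_pow_iff (n := 2) (by norm_num), hz]
    exact Units.isUnit _
  obtain ⟨v, rfl⟩ := hzu
  have h2 : v ^ 2 = b⁻¹ * a := by
    ext
    rw [← hz, Units.val_pow_eq_pow_val]
  have h3 : a = b * v ^ 2 := by
    rw [h2, mul_inv_cancel_left]
  rw [h3, gw_sq]

theorem odd_unit (n : ℤ) (hn : ¬ (2 : ℤ) ∣ n) : IsUnit (n : ℤ_[2]) := by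
  by_contra h
  rw [PadicInt.not_isUnit_iff, PadicInt.norm_int_lt_one_iff_dvd] at h
  exact hn h

/-- The unit of `ℤ₂` given by an odd integer. -/
def ou (n : ℤ) (hn : ¬ (2 : ℤ) ∣ n) : ℤ_[2]ˣ := (odd_unit n hn).unit

theorem ou_val (n : ℤ) (hn : ¬ (2 : ℤ) ∣ n) : (ou n hn : ℤ_[2]) = n := rfl

abbrev u3 : ℤ_[2]ˣ := ou 3 (by norm_num)
abbrev u5 : ℤ_[2]ˣ := ou 5 (by norm_num)
abbrev u7 : ℤ_[2]ˣ := ou 7 (by norm_num)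
abbrev u13 : ℤ_[2]ˣ := ou 13 (by norm_num)
abbrev u39 : ℤ_[2]ˣ := ou 39 (by norm_num)

theorem gw_relZ (a b : Fin 4 → ℤ_[2]ˣ) (a' b' : Fin 4 → ℤ) (P : Matrix (Fin 4) (Fin 4) ℤ)
    (ha : ∀ i, (a i : ℤ_[2]) = a' i) (hb : ∀ i, (b i : ℤ_[2]) = b' i)
    (hP : ¬ (2 : ℤ) ∣ P.det)
    (h : P * Matrix.diagonal a' * P.transpose = Matrix.diagonal b') :
    ∑ i, gw (a i) = ∑ i, gw (b i) := by
  refine gw_rel a b ((Int.castRingHom ℤ_[2]).mapMatrix P) ?_ ?_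
  · rw [← RingHom.map_det]
    exact odd_unit _ hP
  · have := congrArg (Int.castRingHom ℤ_[2]).mapMatrix h
    rw [map_mul, map_mul] at this
    simpa [Matrix.diagonal_map, Matrix.transpose_map, Function.comp_def, ha, hb] using this

theorem rel3 : (4 : ℤ) • (gw (1 : ℤ_[2]ˣ) - gw u3) = 0 := by
  have := gw_relZ (fun _ => 1) (fun _ => u3) (fun _ => 1) (fun _ => 3)
    !![1, 1, 1, 0; -1, 1, 0, 1; -1, 0, 1, -1; 0, -1, 1, 1] (by simp) (by intro i; exact ou_val _ _)
    (by decide) (by decide)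
  simp only [Fin.sum_univ_four] at this
  rw [smul_sub, sub_eq_zero]
  linear_combination (exp := 1) this

theorem rel5 : (2 : ℤ) • (gw (1 : ℤ_[2]ˣ) - gw u5) = 0 := by
  have := gw_relZ ![1, 1, 1, 1] ![u5, u5, 1, 1] ![1, 1, 1, 1] ![5, 5, 1, 1]
    !![1, 2, 0, 0; 2, -1, 0, 0; 0, 0, 1, 0; 0, 0, 0, 1]
    (by intro i; fin_cases i <;> simp) (by intro i; fin_cases i <;> simp [ou_val])
    (by decide) (by decide)
  simp only [Fin.sum_univ_four] at this
  simp at this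
  rw [smul_sub, sub_eq_zero]
  linear_combination (exp := 1) this

theorem rel7 : gw u7 = gw 1 + gw u3 - gw u5 := by
  have := gw_relZ ![1, u3, 1, 1] ![u13, u39, 1, 1] ![1, 3, 1, 1] ![13, 39, 1, 1]
    !![1, 2, 0, 0; 6, -1, 0, 0; 0, 0, 1, 0; 0, 0, 0, 1]
    (by intro i; fin_cases i <;> simp [ou_val]) (by intro i; fin_cases i <;> simp [ou_val])
    (by decide) (by decide)
  simp only [Fin.sum_univ_four] at this
  simp at this
  have e1 : gw u13 = gw u5 := gw_eq_of_red _ _ (by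
    rw [ou_val, ou_val, map_intCast, map_intCast]; decide)
  have e2 : gw u39 = gw u7 := gw_eq_of_red _ _ (by
    rw [ou_val, ou_val, map_intCast, map_intCast]; decide)
  rw [e1, e2] at this
  linear_combination (exp := 1) -this

/-- The homomorphism `ℤ × ℤ/4 × ℤ/2 → GW(ℤ₂)`. -/
def eHom : T →+ GW ℤ_[2] :=
  (zmultiplesHom (GW ℤ_[2]) (gw 1)).coprod
    ((ZMod.lift 4 ⟨zmultiplesHom (GW ℤ_[2]) (gw 1 - gw u3), rel3⟩).coprod
      (ZMod.lift 2 ⟨zmultiplesHom (GW ℤ_[2]) (gw 1 - gw u5), rel5⟩))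

theorem lift_one {A : Type} [AddCommGroup A] (n : ℕ) (f : {f : ℤ →+ A // f n = 0}) :
    ZMod.lift n f 1 = f.1 1 := by
  have := ZMod.lift_coe n f 1
  simpa using this

theorem eHom_1 : eHom (1, 0, 0) = gw 1 := by simp [eHom]

theorem eHom_3 : eHom (0, 1, 0) = gw 1 - gw u3 := by simp [eHom, lift_one]

theorem eHom_5 : eHom (0, 0, 1) = gw 1 - gw u5 := by simp [eHom, lift_one]

theorem red_cases (a : ℤ_[2]ˣ) :
    gw a = gw 1 ∨ gw a = gw u3 ∨ gw a = gw u5 ∨ gw a = gw u7 := by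
  have hm : ∀ u : (ZMod (2 ^ 3))ˣ, (u : ZMod (2 ^ 3)) = 1 ∨ (u : ZMod (2 ^ 3)) = (3 : ℤ) ∨
      (u : ZMod (2 ^ 3)) = (5 : ℤ) ∨ (u : ZMod (2 ^ 3)) = (7 : ℤ) := by
    decide
  rcases hm (Units.map (red : ℤ_[2] →* ZMod (2 ^ 3)) a) with h | h | h | h
  · exact Or.inl (gw_eq_of_red _ _ (h.trans (by simp)))
  · exact Or.inr (Or.inl (gw_eq_of_red _ _ (h.trans (by rw [ou_val, map_intCast]))))
  · exact Or.inr (Or.inr (Or.inl (gw_eq_of_red _ _ (h.trans (by rw [ou_val, map_intCast])))))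
  · exact Or.inr (Or.inr (Or.inr (gw_eq_of_red _ _ (h.trans (by rw [ou_val, map_intCast])))))

theorem eHom_surj : Function.Surjective eHom := by
  intro x
  have k1 : gw (1 : ℤ_[2]ˣ) ∈ eHom.range := ⟨_, eHom_1⟩
  have k3 : gw u3 ∈ eHom.range := by
    have := eHom.range.sub_mem k1 ⟨_, eHom_3⟩
    rwa [sub_sub_cancel] at this
  have k5 : gw u5 ∈ eHom.range := by
    have := eHom.range.sub_mem k1 ⟨_, eHom_5⟩
    rwa [sub_sub_cancel] at this
  have k7 : gw u7 ∈ eHom.range := by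
    rw [rel7]
    exact eHom.range.sub_mem (eHom.range.add_mem k1 k3) k5
  refine gw_span eHom.range ?_ x
  intro a
  rcases red_cases a with h | h | h | h <;> rw [h] <;> assumption

theorem inv8_map (a : ℤ_[2]ˣ) : inv8 (mapGW red (gw a)) = F0 (red a) := by
  rw [mapGW_gw, inv8_gw]
  rfl

theorem comp_id (t : T) : inv8 (mapGW red (eHom t)) = t := by
  have v1 : inv8 (mapGW red (eHom (1, 0, 0))) = (1, 0, 0) := by
    rw [eHom_1, inv8_map, Units.val_one, map_one]; decide
  have v3 : inv8 (mapGW red (eHom (0, 1, 0))) = (0, 1, 0) := by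
    rw [eHom_3, map_sub, map_sub, inv8_map, inv8_map, Units.val_one, map_one, ou_val,
      map_intCast]; decide
  have v5 : inv8 (mapGW red (eHom (0, 0, 1))) = (0, 0, 1) := by
    rw [eHom_5, map_sub, map_sub, inv8_map, inv8_map, Units.val_one, map_one, ou_val,
      map_intCast]; decide
  obtain ⟨n, x, y⟩ := t
  obtain ⟨k, rfl⟩ := ZMod.intCast_surjective x
  obtain ⟨l, rfl⟩ := ZMod.intCast_surjective y
  have ht : ((n, (k : ZMod 4), (l : ZMod 2)) : T) =
      n • ((1, 0, 0) : T) + k • ((0, 1, 0) : T) + l • ((0, 0, 1) : T) := by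
    simp
  rw [ht]
  simp only [map_add, map_zsmul]
  rw [v1, v3, v5]

theorem eHom_inj : Function.Injective eHom :=
  Function.LeftInverse.injective (g := fun x => inv8 (mapGW red x)) comp_id

theorem map_inj : Function.Injective (mapGW red) := by
  intro x y h
  obtain ⟨s, rfl⟩ := eHom_surj x
  obtain ⟨t, rfl⟩ := eHom_surj y
  rw [← comp_id s, ← comp_id t, h]

theorem map_surj : Function.Surjective (mapGW red) := by
  intro x
  refine gw_span (mapGW red).toAddMonoidHom.range ?_ x
  intro a
  have hm : ∀ u : (ZMod (2 ^ 3))ˣ, ∃ n : Fin 8, ¬ (2 : ℤ) ∣ (n : ℕ) ∧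
      (u : ZMod (2 ^ 3)) = (((n : ℕ) : ℤ) : ZMod (2 ^ 3)) := by
    decide
  obtain ⟨n, hn, h⟩ := hm a
  refine ⟨gw (ou _ hn), ?_⟩
  have : Units.map (red : ℤ_[2] →* ZMod (2 ^ 3)) (ou _ hn) = a := by
    ext
    rw [h, Units.coe_map]
    exact map_intCast red _
  rw [← this]
  exact mapGW_gw red _

end GWAux

/-- Reduction modulo `8` induces a ring isomorphism `GW(ℤ₂) ≅ GW(ℤ/8)`;
consequently `GW(ℤ₂) ≅ ℤ × ℤ/4 × ℤ/2` as abelian groups, via `(1,0,0) ↦ [1]`,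
`(0,1,0) ↦ [1] − [3]` and `(0,0,1) ↦ [1] − [5]`. -/
theorem gw_padic_two :
    (∃ ψ : GW ℤ_[2] →+* GW (ZMod (2 ^ 3)),
      (∀ a : ℤ_[2]ˣ,
        ψ (gw a) = gw (Units.map ((PadicInt.toZModPow 3 : ℤ_[2] →+* ZMod (2 ^ 3)) : ℤ_[2] →* ZMod (2 ^ 3)) a)) ∧
      Function.Bijective ψ) ∧
    ∃ (u3 u5 : ℤ_[2]ˣ) (e : ℤ × ZMod 4 × ZMod 2 ≃+ GW ℤ_[2]),
      (u3 : ℤ_[2]) = 3 ∧ (u5 : ℤ_[2]) = 5 ∧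
      e (1, 0, 0) = gw 1 ∧
      e (0, 1, 0) = gw 1 - gw u3 ∧
      e (0, 0, 1) = gw 1 - gw u5 := by
  refine ⟨⟨GWAux.mapGW GWAux.red, fun a => GWAux.mapGW_gw _ a, GWAux.map_inj, GWAux.map_surj⟩,
    GWAux.u3, GWAux.u5, AddEquiv.ofBijective GWAux.eHom ⟨GWAux.eHom_inj, GWAux.eHom_surj⟩,
    ?_, ?_, GWAux.eHom_1, GWAux.eHom_3, GWAux.eHom_5⟩
  · rw [GWAux.ou_val]; norm_num
  · rw [GWAux.ou_val]; norm_num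

end
end

section
/- Let R be the ring 𝔽₂[[x]] of formal power series over 𝔽₂, or the field 𝔽₂((x)) of formal Laurent series over 𝔽₂. Then every 2-fold Pfister form vanishes in GW(R): for all units u, v of R, one has ([1] − [u])·([1] − [v]) = 0 in the ring GW(R). -/
noncomputable section

theorem gw_mul_gw {R : Type} [CommRing R] (a b : Rˣ) : gw a * gw b = gw (a * b) := by
  unfold gw gen
  rw [← map_mul, ← map_mul]
  rfl

theorem gw_one {R : Type} [CommRing R] : gw (1 : Rˣ) = 1 := by
  have h : (gen (1 : Rˣ) : GRing R) = 1 := map_one (MonoidAlgebra.of ℤ (SqCl R))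
  unfold gw
  rw [h, map_one]

theorem gw_rel {R : Type} [CommRing R] (a b : Fin 4 → Rˣ) (P : Matrix (Fin 4) (Fin 4) R)
    (h : P * Matrix.diagonal (fun i => (a i : R)) * P.transpose =
      Matrix.diagonal (fun i => (b i : R))) :
    gw (a 0) + gw (a 1) + gw (a 2) + gw (a 3) = gw (b 0) + gw (b 1) + gw (b 2) + gw (b 3) := by
  have hdet : IsUnit P.det := by
    have h1 := congrArg Matrix.det h
    rw [Matrix.det_mul, Matrix.det_mul, Matrix.det_diagonal, Matrix.det_diagonal] at h1
    have h2 : IsUnit (∏ i, (b i : R)) := by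
      rw [← Units.coe_prod]
      exact Units.isUnit _
    rw [← h1, mul_assoc] at h2
    exact isUnit_of_mul_isUnit_left h2
  have hm : (∑ i, gen (a i)) - (∑ i, gen (b i)) ∈ Ideal.span (gwRel R) :=
    Ideal.subset_span ⟨a, b, P, hdet, h, rfl⟩
  have h3 := Ideal.Quotient.eq.mpr hm
  simp only [Fin.sum_univ_four, map_add] at h3
  exact h3

/-- `⟨1, u⟩ ≅ ⟨v, uv⟩` when `v` is represented by `⟨1, u⟩`. -/
theorem gw_binary {R : Type} [CommRing R] (u v : Rˣ) (s t : R)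
    (h : (v : R) = s ^ 2 + t ^ 2 * u) : gw 1 + gw u = gw v + gw (u * v) := by
  have key := gw_rel ![1, u, 1, 1] ![v, u * v, 1, 1]
    !![s, t, 0, 0; -(u * t), s, 0, 0; 0, 0, 1, 0; 0, 0, 0, 1] (by
      ext i j
      fin_cases i <;> fin_cases j <;>
        simp [Matrix.mul_apply, Fin.sum_univ_four, Matrix.vecMul_diagonal, h] <;> ring)
  simp at key
  exact key

/-- `⟨1, 1, u, 1⟩ ≅ ⟨u, u, 1, u⟩` in characteristic two. -/
theorem gw_two {R : Type} [CommRing R] (h2 : (2 : R) = 0) (u : Rˣ) :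
    gw 1 + gw 1 = gw u + gw u := by
  obtain ⟨w, hw⟩ : ∃ w : R, (u : R) * w = 1 := ⟨_, u.mul_inv⟩
  have key := gw_rel ![1, 1, u, 1] ![u, u, 1, u]
    !![u + w, w, 1, u; u + 1 + w, 1 + w, 1, u; 1, 1, 0, 1; 1, 1, 1, 0] (by
      ext i j
      fin_cases i <;> fin_cases j <;>
        simp [Matrix.mul_apply, Fin.sum_univ_four, Matrix.vecMul_diagonal] <;> grind)
  simp at key
  linear_combination key

theorem pfister_of_rep {R : Type} [CommRing R] (h2 : (2 : R) = 0) (u v : Rˣ) (s t : R)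
    (h : (v : R) = s ^ 2 + t ^ 2 * u) : (gw 1 - gw u) * (gw 1 - gw v) = 0 := by
  have e1 := gw_binary u v s t h
  have e2 := gw_two h2 v
  have e3 := gw_mul_gw u v
  have e4 := gw_one (R := R)
  rw [← e3] at e1
  rw [e4] at e1 e2 ⊢
  linear_combination e2 - e1

theorem pfister_general {R : Type} [CommRing R] [PreValuationRing R] (h2 : (2 : R) = 0) (x : R)
    (hx : ∀ f : R, ∃ a b : R, f = a ^ 2 + x * b ^ 2) (u v : Rˣ) :
    (gw 1 - gw u) * (gw 1 - gw v) = 0 := by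
  obtain ⟨a, b, hu⟩ := hx u
  obtain ⟨a1, b1, hv⟩ := hx v
  rcases ValuationRing.dvd_total b b1 with ⟨c, hc⟩ | ⟨c, hc⟩
  · refine pfister_of_rep h2 u v (a1 + c * a) c ?_
    rw [hu, hv, hc]
    linear_combination (-(a1 * c * a) - c ^ 2 * a ^ 2) * h2
  · rw [mul_comm]
    refine pfister_of_rep h2 v u (a + c * a1) c ?_
    rw [hu, hv, hc]
    linear_combination (-(a1 * c * a) - c ^ 2 * a1 ^ 2) * h2

theorem ps_sq (f : PowerSeries (ZMod 2)) : f ^ 2 = PowerSeries.expand 2 two_ne_zero f := by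
  have h := MvPowerSeries.map_frobenius_expand (σ := Unit) (R := ZMod 2) 2 two_ne_zero (f := f)
  have hf : frobenius (ZMod 2) 2 = RingHom.id _ := Subsingleton.elim _ _
  rw [hf, MvPowerSeries.map_id] at h
  exact h.symm

theorem ps_decomp (f : PowerSeries (ZMod 2)) :
    ∃ a b : PowerSeries (ZMod 2), f = a ^ 2 + PowerSeries.X * b ^ 2 := by
  refine ⟨PowerSeries.mk fun n => f.coeff (2 * n), PowerSeries.mk fun n => f.coeff (2 * n + 1), ?_⟩
  rw [ps_sq, ps_sq]
  ext n
  rcases Nat.even_or_odd' n with ⟨m, rfl | rfl⟩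
  · rcases m with _ | m
    · simp
    · rw [map_add, PowerSeries.coeff_expand_mul, show 2 * (m + 1) = (2 * m + 1) + 1 by ring,
        PowerSeries.coeff_succ_X_mul, PowerSeries.coeff_expand_of_not_dvd _ _ _ (by omega)]
      simp [mul_add]
  · rw [map_add, PowerSeries.coeff_succ_X_mul, PowerSeries.coeff_expand_mul,
      PowerSeries.coeff_expand_of_not_dvd _ _ _ (by omega)]
    simp

theorem ps_two : (2 : PowerSeries (ZMod 2)) = 0 := by
  have h : (2 : ZMod 2) = 0 := rfl
  rw [← map_ofNat (PowerSeries.C (R := ZMod 2)) 2, h, map_zero]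

theorem ls_decomp (f : LaurentSeries (ZMod 2)) :
    ∃ a b : LaurentSeries (ZMod 2), f = a ^ 2 +
      algebraMap (PowerSeries (ZMod 2)) (LaurentSeries (ZMod 2)) PowerSeries.X * b ^ 2 := by
  obtain ⟨⟨p, q⟩, h⟩ := IsLocalization.surj (nonZeroDivisors (PowerSeries (ZMod 2))) f
  have hq : algebraMap (PowerSeries (ZMod 2)) (LaurentSeries (ZMod 2)) q ≠ 0 :=
    IsFractionRing.to_map_ne_zero_of_mem_nonZeroDivisors q.2
  obtain ⟨a, b, hab⟩ := ps_decomp (p * q)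
  have hh := congrArg (algebraMap (PowerSeries (ZMod 2)) (LaurentSeries (ZMod 2))) hab
  simp only [map_add, map_mul, map_pow] at hh
  dsimp only at h
  rw [← h] at hh
  refine ⟨algebraMap _ _ a / algebraMap _ _ (q : PowerSeries (ZMod 2)),
    algebraMap _ _ b / algebraMap _ _ (q : PowerSeries (ZMod 2)), ?_⟩
  field_simp
  linear_combination hh

/-- Every 2-fold Pfister form vanishes in `GW(𝔽₂[[x]])` and in
`GW(𝔽₂((x)))`: for all units `u, v`, `([1] − [u])·([1] − [v]) = 0`. -/
theorem pfister_two_fold_vanishes :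
    (∀ u v : (PowerSeries (ZMod 2))ˣ,
      (gw 1 - gw u) * (gw 1 - gw v) = 0) ∧
    (∀ u v : (LaurentSeries (ZMod 2))ˣ,
      (gw 1 - gw u) * (gw 1 - gw v) = 0) := by
  have hl : (2 : LaurentSeries (ZMod 2)) = 0 := by
    have h := congrArg (algebraMap (PowerSeries (ZMod 2)) (LaurentSeries (ZMod 2))) ps_two
    rwa [map_ofNat, map_zero] at h
  exact ⟨pfister_general ps_two _ ps_decomp, pfister_general hl _ ls_decomp⟩

end
end
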